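/- arXiv:1702.07390 — 2 statements merged into one kernel-verified Lean document; each statement's English description precedes it below -/
import Mathlib

section
/- Let δ ∈ (0, 1/20] and let α₁ > 4.1/δ². There exists N such that for all n ≥ N the following holds: set c = ⌈α₁·ln n⌉ and m = ⌈n/c⌉, and let X₁, …, Xₙ be independent random variables, each uniformly distributed on {1, …, m}. Then with probability at least 1 − 2/(c·n), every group g ∈ {1, …, m} satisfies (1−δ)·c ≤ |{i : Xᵢ = g}| ≤ (1+δ)·c. -/
open MeasureTheory ProbabilityTheory Finset
open scoped ENNReal

lemma card_filter_eq_sum_indicator {Ω ι β : Type*} [Fintype ι] [DecidableEq β]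
    (X : ι → Ω → β) (g : β) :
    (fun ω => ((univ.filter fun i => X i ω = g).card : ℝ)) =
      ∑ i, (fun b => ({g} : Set β).indicator (fun _ => (1 : ℝ)) b) ∘ X i := by
  funext ω
  simp [Finset.sum_apply, Set.indicator_apply, Finset.sum_boole]

section Occupancy

variable {Ω ι β : Type*} [MeasurableSpace Ω] {μ : Measure Ω} [IsProbabilityMeasure μ]

/-- The moment generating function of the indicator of an event is at most that of a Poisson
variable with the same mean. -/
lemma mgf_indicator_one_le {s : Set Ω} (hs : MeasurableSet s) (t : ℝ) :
    mgf (s.indicator fun _ => (1 : ℝ)) μ t ≤ Real.exp (μ.real s * (Real.exp t - 1)) := by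
  have h : (fun ω => Real.exp (t * s.indicator (fun _ => (1 : ℝ)) ω)) =
      fun ω => 1 + s.indicator (fun _ => Real.exp t - 1) ω := by
    funext ω
    by_cases hω : ω ∈ s <;> simp [hω]
  rw [mgf, h, integral_add (integrable_const _) ((integrable_const _).indicator hs),
    integral_indicator_const _ hs]
  simp only [integral_const, probReal_univ, smul_eq_mul, mul_one]
  linarith [Real.add_one_le_exp (μ.real s * (Real.exp t - 1))]

variable [Fintype ι] [MeasurableSpace β] [MeasurableSingletonClass β] [DecidableEq β]
  {X : ι → Ω → β} {g : β} {p : ℝ}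

lemma integrable_exp_mul_card_filter (hX : ∀ i, Measurable (X i)) (t : ℝ) :
    Integrable (fun ω => Real.exp (t * ((univ.filter fun i => X i ω = g).card : ℝ))) μ := by
  have hm : Measurable fun ω => ((univ.filter fun i => X i ω = g).card : ℝ) := by
    rw [card_filter_eq_sum_indicator]
    have hmeas : Measurable fun b => ({g} : Set β).indicator (fun _ => (1 : ℝ)) b :=
      measurable_const.indicator (measurableSet_singleton g)
    rw [Finset.sum_fn]
    exact Finset.measurable_sum _ fun i _ => hmeas.comp (hX i)
  refine Integrable.of_bound (hm.const_mul t).exp.aestronglyMeasurable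
    (Real.exp (|t| * Fintype.card ι)) (ae_of_all _ fun ω => ?_)
  rw [Real.norm_eq_abs, Real.abs_exp, Real.exp_le_exp]
  have hc : ((univ.filter fun i => X i ω = g).card : ℝ) ≤ Fintype.card ι := by
    exact_mod_cast Finset.card_le_univ _
  exact mul_le_mul (le_abs_self t) hc (by positivity) (abs_nonneg t)

lemma mgf_card_filter_le (hX : ∀ i, Measurable (X i)) (hind : iIndepFun X μ)
    (hp : ∀ i, μ.real {ω | X i ω = g} = p) (t : ℝ) :
    mgf (fun ω => ((univ.filter fun i => X i ω = g).card : ℝ)) μ t ≤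
      Real.exp (Fintype.card ι * p * (Real.exp t - 1)) := by
  have hmeas : Measurable fun b => ({g} : Set β).indicator (fun _ => (1 : ℝ)) b :=
    measurable_const.indicator (measurableSet_singleton g)
  rw [card_filter_eq_sum_indicator,
    (hind.comp _ fun _ => hmeas).mgf_sum (fun i => hmeas.comp (hX i))]
  calc _ ≤ ∏ _i : ι, Real.exp (p * (Real.exp t - 1)) := by
        refine Finset.prod_le_prod (fun i _ => mgf_nonneg) fun i _ => ?_
        rw [← hp i]
        exact mgf_indicator_one_le (hX i (measurableSet_singleton g)) t
    _ = _ := by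
        rw [Finset.prod_const, Finset.card_univ, ← Real.exp_nat_mul, mul_assoc]

lemma measureReal_le_card_filter_le (hX : ∀ i, Measurable (X i)) (hind : iIndepFun X μ)
    (hp : ∀ i, μ.real {ω | X i ω = g} = p) {t : ℝ} (ht : 0 ≤ t) (a : ℝ) :
    μ.real {ω | a ≤ ((univ.filter fun i => X i ω = g).card : ℝ)} ≤
      Real.exp (-t * a + Fintype.card ι * p * (Real.exp t - 1)) := by
  rw [Real.exp_add]
  exact (measure_ge_le_exp_mul_mgf a ht (integrable_exp_mul_card_filter hX t)).trans
    (mul_le_mul_of_nonneg_left (mgf_card_filter_le hX hind hp t) (Real.exp_nonneg _))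

lemma measureReal_card_filter_le_le (hX : ∀ i, Measurable (X i)) (hind : iIndepFun X μ)
    (hp : ∀ i, μ.real {ω | X i ω = g} = p) {t : ℝ} (ht : t ≤ 0) (a : ℝ) :
    μ.real {ω | ((univ.filter fun i => X i ω = g).card : ℝ) ≤ a} ≤
      Real.exp (-t * a + Fintype.card ι * p * (Real.exp t - 1)) := by
  rw [Real.exp_add]
  exact (measure_le_le_exp_mul_mgf a ht (integrable_exp_mul_card_filter hX t)).trans
    (mul_le_mul_of_nonneg_left (mgf_card_filter_le hX hind hp t) (Real.exp_nonneg _))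

end Occupancy

/-- The Chernoff exponent of the upper tail: mean `M ≤ c`, threshold `(1 + δ) c`. -/
lemma upper_chernoff_exponent_le {δ c M : ℝ} (hδ0 : 0 < δ) (hδ1 : δ ≤ 1 / 20) (hc : 0 ≤ c)
    (hM : M ≤ c) :
    -δ * ((1 + δ) * c) + M * (Real.exp δ - 1) ≤ -(22 / 45) * (δ ^ 2 * c) := by
  have h := Real.exp_bound' hδ0.le (by linarith) (n := 3) (by norm_num)
  norm_num [Finset.sum_range_succ, Nat.factorial] at h
  have he : Real.exp δ - 1 ≤ δ + 23 / 45 * δ ^ 2 := by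
    nlinarith [mul_nonneg (sq_nonneg δ) (sub_nonneg.2 hδ1)]
  have h0 : 0 ≤ Real.exp δ - 1 := by linarith [Real.add_one_le_exp δ]
  nlinarith [mul_le_mul_of_nonneg_right hM h0, mul_le_mul_of_nonneg_left he hc]

/-- The Chernoff exponent of the lower tail: mean `M ≥ c - e`, threshold `(1 - δ) c`. -/
lemma lower_chernoff_exponent_le {δ c M e : ℝ} (hδ0 : 0 < δ) (hδ1 : δ ≤ 1 / 20) (hc : 0 ≤ c)
    (he0 : 0 ≤ e) (hM : c - e ≤ M) :
    δ * ((1 - δ) * c) + M * (Real.exp (-δ) - 1) ≤ e - 22 / 45 * (δ ^ 2 * c) := by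
  have hexp : Real.exp (-δ) - 1 ≤ -δ + δ ^ 2 / 2 := by
    have h1 := Real.quadratic_le_exp_of_nonneg hδ0.le
    have h2 : Real.exp (-δ) * Real.exp δ = 1 := by rw [← Real.exp_add]; simp
    have h3 := Real.exp_pos (-δ)
    have h4 : Real.exp (-δ) * (1 + δ + δ ^ 2 / 2) ≤ 1 := by nlinarith
    have h5 : 0 < 1 + δ + δ ^ 2 / 2 := by positivity
    have h6 : 1 ≤ (1 - δ + δ ^ 2 / 2) * (1 + δ + δ ^ 2 / 2) := by nlinarith [sq_nonneg (δ ^ 2)]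
    have := le_of_mul_le_mul_right (h4.trans h6) h5
    linarith
  have h0 : Real.exp (-δ) - 1 ≤ 0 := by
    linarith [Real.exp_le_one_iff.2 (neg_nonpos.2 hδ0.le)]
  have h1 : -1 ≤ Real.exp (-δ) - 1 := by linarith [Real.exp_pos (-δ)]
  nlinarith [mul_le_mul_of_nonpos_right hM h0, mul_le_mul_of_nonneg_left hexp hc,
    mul_nonneg he0 (by linarith : 0 ≤ 1 + (Real.exp (-δ) - 1)), mul_nonneg hc (sq_nonneg δ)]

lemma eventually_sq_ceil_mul_log_le (a : ℝ) (ha : 0 < a) :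
    ∀ᶠ n : ℕ in Filter.atTop, (⌈a * Real.log n⌉₊ : ℝ) ^ 2 ≤ n := by
  have hlog := Real.tendsto_log_atTop.comp (tendsto_natCast_atTop_atTop (R := ℝ))
  have ho := ((Real.isLittleO_pow_log_id_atTop (n := 2)).comp_tendsto
    (tendsto_natCast_atTop_atTop (R := ℝ))).def (c := 1 / (a + 1) ^ 2) (by positivity)
  filter_upwards [ho, hlog.eventually_ge_atTop 1] with n hn hL
  simp only [Function.comp_apply, id, Real.norm_eq_abs, abs_pow, sq_abs, Nat.abs_cast] at hn hL
  have hceil : (⌈a * Real.log n⌉₊ : ℝ) ≤ (a + 1) * Real.log n := by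
    have := Nat.ceil_lt_add_one (a := a * Real.log n) (by positivity)
    linarith
  calc (⌈a * Real.log n⌉₊ : ℝ) ^ 2 ≤ ((a + 1) * Real.log n) ^ 2 := by gcongr
    _ = (a + 1) ^ 2 * Real.log n ^ 2 := by ring
    _ ≤ (a + 1) ^ 2 * (1 / (a + 1) ^ 2 * n) := by gcongr
    _ = n := by field_simp

/-- A union bound over groups, with two tail events for each group. -/
lemma one_sub_two_div_le_measure_forall {Ω κ : Type*} [MeasurableSpace Ω] {μ : Measure Ω}
    [IsProbabilityMeasure μ] [Fintype κ] {f : κ → Ω → ℝ} {a b ε : ℝ}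
    (hlo : ∀ g, μ.real {ω | f g ω ≤ a} ≤ ε) (hup : ∀ g, μ.real {ω | b ≤ f g ω} ≤ ε)
    {K : ℝ≥0∞} (hK : ENNReal.ofReal (Fintype.card κ * (2 * ε)) ≤ K) :
    1 - K ≤ μ {ω | ∀ g, a ≤ f g ω ∧ f g ω ≤ b} := by
  have hcover : (Set.univ : Set Ω) ⊆ {ω | ∀ g, a ≤ f g ω ∧ f g ω ≤ b} ∪
      ⋃ g, ({ω | f g ω ≤ a} ∪ {ω | b ≤ f g ω}) := by
    intro ω _
    by_contra! h
    simp only [Set.mem_union, Set.mem_ofPred_eq, Set.mem_iUnion, not_or, not_exists, not_le] at h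
    exact h.1 fun g => ⟨(h.2 g).1.le, (h.2 g).2.le⟩
  have hbad : μ (⋃ g, ({ω | f g ω ≤ a} ∪ {ω | b ≤ f g ω})) ≤ K := by
    refine le_trans ?_ hK
    rw [← ofReal_measureReal]
    refine ENNReal.ofReal_le_ofReal ((measureReal_iUnion_fintype_le _).trans ?_)
    calc _ ≤ ∑ _g : κ, 2 * ε := Finset.sum_le_sum fun g _ =>
          (measureReal_union_le _ _).trans (by linarith [hlo g, hup g])
      _ = _ := by simp
  rw [tsub_le_iff_right]
  calc (1 : ℝ≥0∞) = μ Set.univ := measure_univ.symm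
    _ ≤ _ := (measure_mono hcover).trans (measure_union_le _ _)
    _ ≤ _ := by gcongr

/-- **Group-size concentration in the double planted model.** For `δ ∈ (0, 1/20]` and
`α₁ > 4.1/δ²`, there is `N` such that for all `n ≥ N`, with `c = ⌈α₁ · ln n⌉` and
`m = ⌈n/c⌉`: if `X₁, …, Xₙ` are independent random variables each uniform on the `m` groups,
then with probability at least `1 − 2/(c·n)` every group `g` has between `(1−δ)·c` and
`(1+δ)·c` of the `Xᵢ` equal to it. -/
theorem double_planted_group_sizes
    (δ : ℝ) (hδ0 : 0 < δ) (hδ1 : δ ≤ 1 / 20) (α₁ : ℝ) (hα₁ : 4.1 / δ ^ 2 < α₁) :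
    ∃ N : ℕ, ∀ n : ℕ, N ≤ n →
      let c : ℕ := ⌈α₁ * Real.log n⌉₊
      let m : ℕ := ⌈(n : ℝ) / (c : ℝ)⌉₊
      ∀ (Ω : Type) (_ : MeasureSpace Ω), IsProbabilityMeasure (ℙ : Measure Ω) →
      ∀ X : Fin n → Ω → Fin m,
        (∀ i, Measurable (X i)) →
        iIndepFun X ℙ →
        (∀ i : Fin n, ∀ g : Fin m, ℙ {ω | X i ω = g} = ((m : ℝ≥0∞))⁻¹) →
        1 - 2 / ((c : ℝ≥0∞) * (n : ℝ≥0∞)) ≤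
          ℙ {ω | ∀ g : Fin m,
            (1 - δ) * (c : ℝ) ≤ ((Finset.univ.filter fun i : Fin n => X i ω = g).card : ℝ) ∧
            ((Finset.univ.filter fun i : Fin n => X i ω = g).card : ℝ) ≤ (1 + δ) * (c : ℝ)} := by
  have hα0 : 0 < α₁ := lt_trans (by positivity) hα₁
  have hlog := Real.tendsto_log_atTop.comp (tendsto_natCast_atTop_atTop (R := ℝ))
  obtain ⟨N, hN⟩ := Filter.eventually_atTop.1
    ((eventually_sq_ceil_mul_log_le α₁ hα0).and
      ((hlog.eventually_ge_atTop 500).and (Filter.eventually_ge_atTop 1)))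
  refine ⟨N, fun n hn => ?_⟩
  obtain ⟨hcn, hL, hn1⟩ := hN n hn
  intro c m Ω _ _ X hX hind hunif
  simp only [Function.comp_apply] at hL
  have hn0 : (0 : ℝ) < n := by exact_mod_cast hn1
  have hcL : α₁ * Real.log n ≤ c := Nat.le_ceil _
  have hc0 : (0 : ℝ) < c := lt_of_lt_of_le (by positivity) hcL
  have hc1 : (1 : ℝ) ≤ c := by exact_mod_cast hc0
  change (c : ℝ) ^ 2 ≤ n at hcn
  have hm : (n : ℝ) / c ≤ m := Nat.le_ceil _
  have hm' : (m : ℝ) ≤ n / c + 1 := (Nat.ceil_lt_add_one (by positivity)).le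
  have hm0 : (0 : ℝ) < m := lt_of_lt_of_le (by positivity) hm
  rw [div_le_iff₀ hc0] at hm
  have hm'' : (m : ℝ) * c ≤ n + c := by
    calc (m : ℝ) * c ≤ (n / c + 1) * c := by gcongr
      _ = n + c := by field_simp
  have hp : ∀ g i, (ℙ : Measure Ω).real {ω | X i ω = g} = (m : ℝ)⁻¹ := fun g i => by
    simp [measureReal_def, hunif]
  have hM : (Fintype.card (Fin n) : ℝ) * (m : ℝ)⁻¹ ≤ c := by
    rw [Fintype.card_fin, ← div_eq_mul_inv, div_le_iff₀ hm0]
    linarith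
  have hM' : (c : ℝ) - 1 ≤ (Fintype.card (Fin n) : ℝ) * (m : ℝ)⁻¹ := by
    rw [Fintype.card_fin, ← div_eq_mul_inv, le_div_iff₀ hm0]
    have : (c : ℝ) ≤ m := by
      refine le_of_mul_le_mul_right ?_ hc0
      nlinarith
    nlinarith
  have hrate : 2.004 * Real.log n ≤ 22 / 45 * (δ ^ 2 * c) := by
    have h1 : 4.1 < α₁ * δ ^ 2 := (div_lt_iff₀ (by positivity)).1 hα₁
    have h2 : δ ^ 2 * (α₁ * Real.log n) ≤ δ ^ 2 * c := by gcongr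
    nlinarith
  refine one_sub_two_div_le_measure_forall (ε := Real.exp (1 - 2.004 * Real.log n))
    (f := fun g ω => ((univ.filter fun i => X i ω = g).card : ℝ)) (fun g => ?_) (fun g => ?_) ?_
  · refine (measureReal_card_filter_le_le hX hind (hp g) (neg_nonpos.2 hδ0.le) _).trans
      (Real.exp_le_exp.2 ?_)
    rw [neg_neg]
    linarith [lower_chernoff_exponent_le hδ0 hδ1 hc0.le zero_le_one hM']
  · refine (measureReal_le_card_filter_le hX hind (hp g) hδ0.le _).trans (Real.exp_le_exp.2 ?_)
    linarith [upper_chernoff_exponent_le hδ0 hδ1 hc0.le hM]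
  · have hK : (2 : ℝ≥0∞) / (c * n) = ENNReal.ofReal (2 / (c * n)) := by
      rw [ENNReal.ofReal_div_of_pos (by positivity), ENNReal.ofReal_mul (by positivity)]
      simp
    rw [hK, Fintype.card_fin]
    refine ENNReal.ofReal_le_ofReal ?_
    rw [le_div_iff₀ (by positivity)]
    have hcmn : (m : ℝ) * c * n ≤ 2 * Real.exp (2 * Real.log n) := by
      rw [two_mul (Real.log _), Real.exp_add, Real.exp_log hn0]
      have hcn1 : (c : ℝ) ≤ n := by nlinarith
      nlinarith
    have hexp : 2 * Real.exp (2 * Real.log n) * Real.exp (1 - 2.004 * Real.log n) ≤ 1 := by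
      rw [mul_assoc, ← Real.exp_add]
      calc 2 * Real.exp (2 * Real.log n + (1 - 2.004 * Real.log n))
          ≤ Real.exp 1 * Real.exp (-1) := by
            gcongr
            · linarith [Real.add_one_le_exp (1 : ℝ)]
            · linarith
        _ = 1 := by rw [← Real.exp_add]; simp
    have := mul_le_mul_of_nonneg_right hcmn (Real.exp_nonneg (1 - 2.004 * Real.log n))
    linarith
end

section
/- Let α₁ > 0. There exists N such that for all n ≥ N the following holds: set c = ⌈α₁·ln n⌉ and m = ⌈n/c⌉, and let X₁, …, Xₙ and Y₁, …, Yₙ be mutually independent random variables, each uniformly distributed on {1, …, m}. Then with probability at least 1 − c⁶/n², every pair (i, j) ∈ {1,…,m}² satisfies |{v : Xᵥ = i and Yᵥ = j}| ≤ 3. -/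
open MeasureTheory ProbabilityTheory Finset
open scoped ENNReal

/-- Independent uniform labels `X v`, `Y v`, `v ∈ S`, all take the prescribed values `i`, `j` with
probability `(m⁻¹) ^ (2 * #S)`. -/
lemma measure_forall_labels_eq {Ω V : Type*} [MeasurableSpace Ω] {μ : Measure Ω} {m : ℕ}
    {X Y : V → Ω → Fin m} (hind : iIndepFun (Sum.elim X Y : V ⊕ V → Ω → Fin m) μ)
    (hX : ∀ v g, μ {ω | X v ω = g} = (m : ℝ≥0∞)⁻¹)
    (hY : ∀ v g, μ {ω | Y v ω = g} = (m : ℝ≥0∞)⁻¹) (S : Finset V) (i j : Fin m) :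
    μ {ω | ∀ v ∈ S, X v ω = i ∧ Y v ω = j} = (m : ℝ≥0∞)⁻¹ ^ (2 * #S) := by
  have h := hind.measure_inter_preimage_eq_mul (S := S.disjSum S)
    (sets := Sum.elim (fun _ => {i}) (fun _ => {j})) (fun _ _ => MeasurableSet.of_discrete)
  have hset : {ω | ∀ v ∈ S, X v ω = i ∧ Y v ω = j} = ⋂ w ∈ S.disjSum S,
      (Sum.elim X Y w) ⁻¹' (Sum.elim (fun _ => {i}) (fun _ => {j}) : V ⊕ V → Set (Fin m)) w := by
    ext ω
    simp [Finset.mem_disjSum, forall_and]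
  rw [hset, h, Finset.prod_disjSum]
  have hX' : ∀ v, μ (X v ⁻¹' {i}) = (m : ℝ≥0∞)⁻¹ := fun v => hX v i
  have hY' : ∀ v, μ (Y v ⁻¹' {j}) = (m : ℝ≥0∞)⁻¹ := fun v => hY v j
  simp only [Sum.elim_inl, Sum.elim_inr, hX', hY', Finset.prod_const]
  rw [← pow_add, two_mul]

/-- Union bound for the event that some pair of groups shares more than `k` nodes. -/
lemma measure_exists_lt_card_inter_le {Ω V : Type*} [Fintype V] [MeasurableSpace Ω]
    {μ : Measure Ω} {m : ℕ}
    {X Y : V → Ω → Fin m} (hind : iIndepFun (Sum.elim X Y : V ⊕ V → Ω → Fin m) μ)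
    (hX : ∀ v g, μ {ω | X v ω = g} = (m : ℝ≥0∞)⁻¹)
    (hY : ∀ v g, μ {ω | Y v ω = g} = (m : ℝ≥0∞)⁻¹) (k : ℕ) :
    μ {ω | ∃ i j : Fin m, k < #{v | X v ω = i ∧ Y v ω = j}} ≤
      (Fintype.card V).choose (k + 1) * ((m : ℝ≥0∞) ^ 2 * (m : ℝ≥0∞)⁻¹ ^ (2 * (k + 1))) := by
  have hsub : {ω | ∃ i j : Fin m, k < #{v | X v ω = i ∧ Y v ω = j}} ⊆
      ⋃ p ∈ (univ.powersetCard (k + 1) : Finset (Finset V)) ×ˢ (univ : Finset (Fin m × Fin m)),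
        {ω | ∀ v ∈ p.1, X v ω = p.2.1 ∧ Y v ω = p.2.2} := by
    rintro ω ⟨i, j, hij⟩
    obtain ⟨S, hS, hcard⟩ := Finset.exists_subset_card_eq (Nat.succ_le_of_lt hij)
    simp only [Set.mem_iUnion, exists_prop]
    refine ⟨(S, (i, j)), by simpa [Finset.mem_powersetCard] using hcard, fun v hv => ?_⟩
    simpa using hS hv
  refine (measure_mono hsub).trans ((measure_biUnion_finset_le _ _).trans_eq ?_)
  have hterm : ∀ p ∈ (univ.powersetCard (k + 1) : Finset (Finset V)) ×ˢ
      (univ : Finset (Fin m × Fin m)),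
      μ {ω | ∀ v ∈ p.1, X v ω = p.2.1 ∧ Y v ω = p.2.2} = (m : ℝ≥0∞)⁻¹ ^ (2 * (k + 1)) := by
    intro p hp
    rw [measure_forall_labels_eq hind hX hY,
      (Finset.mem_powersetCard.1 (Finset.mem_product.1 hp).1).2]
  rw [Finset.sum_congr rfl hterm]
  simp [Finset.card_product, Finset.card_powersetCard, sq, mul_assoc]

/-- The union bound for four common nodes is at most `c ^ 6 / n ^ 2` once `n ≤ m * c`. -/
lemma choose_four_mul_le {n m c : ℕ} (hn : n ≠ 0) (h : n ≤ m * c) :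
    (n.choose 4 : ℝ≥0∞) * ((m : ℝ≥0∞) ^ 2 * (m : ℝ≥0∞)⁻¹ ^ 8) ≤
      (c : ℝ≥0∞) ^ 6 / (n : ℝ≥0∞) ^ 2 := by
  have hm : m ≠ 0 := by rintro rfl; simp at h; exact hn h
  have hm0 : (m : ℝ≥0∞) ≠ 0 := by exact_mod_cast hm
  have hmt : (m : ℝ≥0∞) ≠ ∞ := ENNReal.natCast_ne_top m
  have hcancel : (m : ℝ≥0∞) ^ 2 * (m : ℝ≥0∞)⁻¹ ^ 8 = ((m : ℝ≥0∞) ^ 6)⁻¹ := by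
    rw [show (8 : ℕ) = 2 + 6 from rfl, pow_add, ← mul_assoc, ← mul_pow,
      ENNReal.mul_inv_cancel hm0 hmt, one_pow, one_mul, ENNReal.inv_pow]
  rw [hcancel, ENNReal.le_div_iff_mul_le (by left; simpa using hn) (by left; simp), mul_right_comm,
    ← div_eq_mul_inv]
  refine ENNReal.div_le_of_le_mul ?_
  have hnat : n.choose 4 * n ^ 2 ≤ c ^ 6 * m ^ 6 :=
    calc n.choose 4 * n ^ 2 ≤ n ^ 4 * n ^ 2 := Nat.mul_le_mul_right _ (Nat.choose_le_pow n 4)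
      _ = n ^ 6 := by ring
      _ ≤ (m * c) ^ 6 := Nat.pow_le_pow_left h 6
      _ = c ^ 6 * m ^ 6 := by ring
  exact_mod_cast hnat

/-- **Intersection-size lemma for the double planted model.** For `α₁ > 0` there is `N` such
that for all `n ≥ N`, with `c = ⌈α₁ · ln n⌉` and `m = ⌈n/c⌉`: if `X₁, …, Xₙ, Y₁, …, Yₙ` are
mutually independent random variables each uniform on the `m` groups (the `Xᵥ` being Type-1
group labels and the `Yᵥ` Type-2 group labels), then with probability at least `1 − c⁶/n²`
every Type-1 group intersects every Type-2 group in at most `3` nodes. -/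
theorem double_planted_intersection_sizes (α₁ : ℝ) (hα₁ : 0 < α₁) :
    ∃ N : ℕ, ∀ n : ℕ, N ≤ n →
      let c : ℕ := ⌈α₁ * Real.log n⌉₊
      let m : ℕ := ⌈(n : ℝ) / (c : ℝ)⌉₊
      ∀ (Ω : Type) (_ : MeasureSpace Ω), IsProbabilityMeasure (ℙ : Measure Ω) →
      ∀ X Y : Fin n → Ω → Fin m,
        (∀ v, Measurable (X v)) → (∀ v, Measurable (Y v)) →
        iIndepFun
          (Sum.elim X Y : Fin n ⊕ Fin n → Ω → Fin m) ℙ →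
        (∀ v : Fin n, ∀ g : Fin m, ℙ {ω | X v ω = g} = ((m : ℝ≥0∞))⁻¹) →
        (∀ v : Fin n, ∀ g : Fin m, ℙ {ω | Y v ω = g} = ((m : ℝ≥0∞))⁻¹) →
        1 - (c : ℝ≥0∞) ^ 6 / (n : ℝ≥0∞) ^ 2 ≤
          ℙ {ω | ∀ i j : Fin m,
            (Finset.univ.filter fun v : Fin n => X v ω = i ∧ Y v ω = j).card ≤ 3} := by
  refine ⟨2, fun n hn => ?_⟩
  intro c m Ω _ _ X Y _ _ hind hX hY
  have hc : 0 < c :=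
    Nat.ceil_pos.2 (mul_pos hα₁ (Real.log_pos (by exact_mod_cast Nat.lt_of_succ_le hn)))
  have hnm : n ≤ m * c := by
    have h := (div_le_iff₀ (by exact_mod_cast hc : (0 : ℝ) < c)).1 (Nat.le_ceil ((n : ℝ) / c))
    exact_mod_cast h
  have hbad := (measure_exists_lt_card_inter_le hind hX hY 3).trans
    (by simpa using choose_four_mul_le (by lia) hnm)
  rw [tsub_le_iff_right, ← measure_univ (μ := (ℙ : Measure Ω))]
  refine le_trans (measure_mono fun ω _ => ?_)
    ((measure_union_le _ _).trans (add_le_add_right hbad _))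
  by_cases hω : ∀ i j : Fin m, #{v | X v ω = i ∧ Y v ω = j} ≤ 3
  · exact Or.inl hω
  · push Not at hω
    exact Or.inr hω
end
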